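/- All four modelling approaches model exactly the same problem: for any nonnegative unit costs C_pv, C_bt, the optimal values (infima of the cost, taken in the extended nonnegative reals with inf ∅ = ∞) of the 1BB-1F model (cost Σ_t [C_pv·(f_pv_bt(t)+f_pv_ed(t)) + C_bt·f_bt_ed(t)]), the 2BB-1F model, the 2BB-2F model, and the 3BB-4F model (cost Σ_t [C_pv·f_pv_cp(t) + C_bt·f_bt_cp(t)] in each of the latter three) all coincide. -/

import Mathlib

open Finset

/-- Storage level at the end of the previous period (`S0` for the first period). -/
def sprev (T : ℕ) (S0 : ℝ) (s : Fin T → ℝ) (t : Fin T) : ℝ :=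
  if (t : ℕ) = 0 then S0
  else s ⟨(t : ℕ) - 1, Nat.lt_of_le_of_lt (Nat.sub_le _ _) t.isLt⟩

/-- 1BB-1F feasible set. -/
def Feas1BB (T : ℕ) (Pbt Sbt S0 etain etaout : ℝ) (Ppv D : Fin T → ℝ)
    (fbted fpvbt fpved s : Fin T → ℝ) : Prop :=
  ∀ t : Fin T,
    0 ≤ fbted t ∧ 0 ≤ fpvbt t ∧ 0 ≤ fpved t ∧ 0 ≤ s t ∧
    fbted t + fpved t = D t ∧
    s t = sprev T S0 s t + etain * fpvbt t - (1 / etaout) * fbted t ∧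
    fbted t ≤ Pbt ∧ fpvbt t ≤ Pbt ∧ fpvbt t + fpved t ≤ Ppv t ∧ s t ≤ Sbt

/-- 2BB-1F feasible set. -/
def Feas2BB1F (T : ℕ) (Pbt Sbt S0 etain etaout : ℝ) (Ppv D : Fin T → ℝ)
    (fbtcp fpvcp fcpbt fcped s : Fin T → ℝ) : Prop :=
  ∀ t : Fin T,
    0 ≤ fbtcp t ∧ 0 ≤ fpvcp t ∧ 0 ≤ fcpbt t ∧ 0 ≤ fcped t ∧ 0 ≤ s t ∧
    fbtcp t + fpvcp t = fcpbt t + fcped t ∧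
    fcped t = D t ∧
    s t = sprev T S0 s t + etain * fcpbt t - (1 / etaout) * fbtcp t ∧
    fbtcp t ≤ Pbt ∧ fcpbt t ≤ Pbt ∧ fpvcp t ≤ Ppv t ∧
    fcped t ≤ Pbt + Ppv t ∧ s t ≤ Sbt

/-- 2BB-2F feasible set (grid-to-battery charging forbidden). -/
def Feas2BB2F (T : ℕ) (Pbt Sbt S0 etain etaout : ℝ) (Ppv D : Fin T → ℝ)
    (fbtcp fpvcp fcpbt fcped fedcp s : Fin T → ℝ) : Prop :=
  ∀ t : Fin T,
    0 ≤ fbtcp t ∧ 0 ≤ fpvcp t ∧ 0 ≤ fcpbt t ∧ 0 ≤ fcped t ∧ 0 ≤ fedcp t ∧ 0 ≤ s t ∧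
    fbtcp t + fpvcp t + fedcp t = fcpbt t + fcped t ∧
    fcped t = D t + fedcp t ∧
    s t = sprev T S0 s t + etain * fcpbt t - (1 / etaout) * fbtcp t ∧
    fbtcp t ≤ Pbt ∧ fcpbt t ≤ Pbt ∧ fpvcp t ≤ Ppv t ∧ fedcp t = 0 ∧
    fcped t ≤ Pbt + Ppv t ∧ s t ≤ Sbt

/-- 3BB-4F feasible set (grid-to-battery charging forbidden via `fclcp = 0`). -/
def Feas3BB4F (T : ℕ) (Pbt Sbt S0 etain etaout : ℝ) (Ppv D : Fin T → ℝ)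
    (fbtcp fpvcp fclcp fcpbt fcpcl fcled fedcl s : Fin T → ℝ) : Prop :=
  ∀ t : Fin T,
    0 ≤ fbtcp t ∧ 0 ≤ fpvcp t ∧ 0 ≤ fclcp t ∧ 0 ≤ fcpbt t ∧ 0 ≤ fcpcl t ∧
    0 ≤ fcled t ∧ 0 ≤ fedcl t ∧ 0 ≤ s t ∧
    fbtcp t + fpvcp t + fclcp t = fcpbt t + fcpcl t ∧
    fcled t = D t + fedcl t ∧
    fcpcl t + fedcl t = fclcp t + fcled t ∧
    s t = sprev T S0 s t + etain * fcpbt t - (1 / etaout) * fbtcp t ∧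
    fbtcp t ≤ Pbt ∧ fcpbt t ≤ Pbt ∧ fpvcp t ≤ Ppv t ∧ fclcp t = 0 ∧
    fcpcl t ≤ Pbt + Ppv t ∧ fcled t ≤ Pbt + Ppv t ∧ fedcl t ≤ Pbt + Ppv t ∧ s t ≤ Sbt

/-- The previous storage level of the shift of a sequence is the sequence itself. -/
theorem sprev_shift (T : ℕ) (u : ℕ → ℝ) (t : Fin T) :
    sprev T (u 0) (fun i => u (i + 1)) t = u t := by
  unfold sprev
  split_ifs with h
  · rw [h]
  · simp only [Nat.sub_add_cancel (Nat.one_le_iff_ne_zero.mpr h)]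

/-- Storage trajectory with increments `g`, where any overflow beyond `Sbt` is curtailed. -/
noncomputable def cappedStorage (T : ℕ) (Sbt S0 : ℝ) (g : Fin T → ℝ) : ℕ → ℝ
  | 0 => S0
  | n + 1 =>
    if h : n < T then min Sbt (cappedStorage T Sbt S0 g n + g ⟨n, h⟩)
    else cappedStorage T Sbt S0 g n

theorem cappedStorage_succ (T : ℕ) (Sbt S0 : ℝ) (g : Fin T → ℝ) (t : Fin T) :
    cappedStorage T Sbt S0 g (t + 1) = min Sbt (cappedStorage T Sbt S0 g t + g t) := by
  simp [cappedStorage]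

theorem cappedStorage_le {T : ℕ} {Sbt S0 : ℝ} (g : Fin T → ℝ) (h0 : S0 ≤ Sbt) (n : ℕ) :
    cappedStorage T Sbt S0 g n ≤ Sbt := by
  induction n with
  | zero => exact h0
  | succ n ih =>
    rw [cappedStorage]
    split_ifs
    · exact min_le_left _ _
    · exact ih

/-- A bounded trajectory with increments at most `g` stays below the capped one. -/
theorem le_cappedStorage {T : ℕ} {Sbt S0 : ℝ} {g s : Fin T → ℝ} (hs : ∀ t, s t ≤ Sbt)
    (hg : ∀ t, s t ≤ sprev T S0 s t + g t) (t : Fin T) :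
    s t ≤ cappedStorage T Sbt S0 g (t + 1) := by
  obtain ⟨n, hn⟩ := t
  induction n with
  | zero =>
    rw [cappedStorage_succ]
    exact le_min (hs _) (by simpa [sprev, cappedStorage] using hg ⟨0, hn⟩)
  | succ n ih =>
    rw [cappedStorage_succ]
    have h1 := hg ⟨n + 1, hn⟩
    have h2 := ih (by omega)
    simp only [sprev, Nat.add_one_ne_zero, if_false, Nat.add_sub_cancel] at h1
    exact le_min (hs _) (h1.trans (by simpa using h2))

/-- Removing simultaneous charging and discharging, and curtailing the resulting storage overflow,
turns a 2BB-1F solution into a 1BB-1F solution without increasing any flow. -/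
theorem Feas2BB1F.exists_feas1BB {T : ℕ} {Pbt Sbt S0 etain etaout : ℝ} (hS0' : S0 ≤ Sbt)
    (hin : 0 < etain) (hin1 : etain ≤ 1) (hout : 0 < etaout) (hout1 : etaout ≤ 1)
    {Ppv D : Fin T → ℝ} (hD : ∀ t, 0 ≤ D t) {b p c d s : Fin T → ℝ}
    (h : Feas2BB1F T Pbt Sbt S0 etain etaout Ppv D b p c d s) :
    ∃ b' c' e' s' : Fin T → ℝ, Feas1BB T Pbt Sbt S0 etain etaout Ppv D b' c' e' s' ∧
      ∀ t, c' t + e' t ≤ p t ∧ b' t ≤ b t := by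
  set b' : Fin T → ℝ := fun t => min (b t) (D t) with hb'
  set g : Fin T → ℝ := fun t => etain * min (c t) (p t) - (1 / etaout) * b' t with hg
  set u := cappedStorage T Sbt S0 g with hu
  set c' : Fin T → ℝ := fun t => (u (t + 1) - u t + (1 / etaout) * b' t) / etain with hc'
  have hout2 : 1 ≤ 1 / etaout := by rwa [le_div_iff₀ hout, one_mul]
  have hsu : ∀ t : Fin T, s t ≤ u (t + 1) := by
    refine fun t => le_cappedStorage (fun t => (h t).2.2.2.2.2.2.2.2.2.2.2.2) (fun t => ?_) t
    obtain ⟨-, -, -, -, -, h1, h2, h3, -⟩ := h t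
    simp only [hg, hb']
    rcases le_total (b t) (D t) with hbd | hbd
    · rw [min_eq_left hbd, min_eq_left (by linarith)]
      linarith
    · rw [min_eq_right hbd, min_eq_right (by linarith)]
      have hp : p t = c t - (b t - D t) := by linarith
      rw [h3, hp]
      nlinarith [mul_nonneg (sub_nonneg.2 hbd) (sub_nonneg.2 (hin1.trans hout2))]
  have hb0 : ∀ t, 0 ≤ b' t := fun t => le_min (h t).1 (hD t)
  have hc0 : ∀ t, 0 ≤ c' t := by
    intro t
    refine div_nonneg ?_ hin.le
    have h1 : 0 ≤ (1 / etaout) * b' t := mul_nonneg (by linarith) (hb0 t)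
    have h2 : 0 ≤ etain * min (c t) (p t) :=
      mul_nonneg hin.le (le_min (h t).2.2.1 (h t).2.1)
    have h3 : u t - (1 / etaout) * b' t ≤ u (t + 1) := by
      rw [hu, cappedStorage_succ]
      refine le_min ?_ ?_
      · linarith [cappedStorage_le g hS0' (t : ℕ)]
      · simp only [hg]
        linarith
    linarith
  have hc1 : ∀ t, c' t ≤ min (c t) (p t) := by
    intro t
    rw [hc', div_le_iff₀ hin]
    have h1 : u (t + 1) ≤ u t + g t := by
      rw [hu, cappedStorage_succ]
      exact min_le_right _ _
    simp only [hg] at h1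
    linarith
  have hce : ∀ t, c' t + (D t - b' t) ≤ p t := by
    intro t
    have h1 := hc1 t
    obtain ⟨-, -, -, -, -, h2, h3, -⟩ := h t
    simp only [hb']
    rcases le_total (b t) (D t) with hbd | hbd
    · rw [min_eq_left hbd]
      linarith [min_le_left (c t) (p t)]
    · rw [min_eq_right hbd]
      linarith [min_le_right (c t) (p t)]
  refine ⟨b', c', fun t => D t - b' t, fun t => u (t + 1), fun t => ?_,
    fun t => ⟨hce t, min_le_left _ _⟩⟩
  have hsp : sprev T S0 (fun i => u (i + 1)) t = u t := sprev_shift T u t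
  obtain ⟨-, -, -, -, h1, -, -, -, h2, h3, h4, -, -⟩ := h t
  refine ⟨hb0 t, hc0 t, sub_nonneg.2 (min_le_right _ _), h1.trans (hsu t), by ring, ?_,
    (min_le_left _ _).trans h2, ((hc1 t).trans (min_le_left _ _)).trans h3, (hce t).trans h4,
    cappedStorage_le g hS0' _⟩
  rw [hsp, hc', mul_div_cancel₀ _ hin.ne']
  ring

/-- all four modelling approaches have the same optimal value. -/
theorem stmt12 (T : ℕ) (hT : 1 ≤ T) (Pbt Sbt S0 etain etaout : ℝ)
    (hPbt : 0 ≤ Pbt) (hSbt : 0 ≤ Sbt) (hS0 : 0 ≤ S0) (hS0' : S0 ≤ Sbt)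
    (hin : 0 < etain) (hin1 : etain ≤ 1) (hout : 0 < etaout) (hout1 : etaout ≤ 1)
    (Ppv D : Fin T → ℝ) (hPpv : ∀ t, 0 ≤ Ppv t) (hD : ∀ t, 0 ≤ D t)
    (Cpv Cbt : ℝ) (hCpv : 0 ≤ Cpv) (hCbt : 0 ≤ Cbt) :
    (sInf {c : ENNReal | ∃ fbted fpvbt fpved s : Fin T → ℝ,
        Feas1BB T Pbt Sbt S0 etain etaout Ppv D fbted fpvbt fpved s ∧
        c = ENNReal.ofReal (∑ t, (Cpv * (fpvbt t + fpved t) + Cbt * fbted t))}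
      = sInf {c : ENNReal | ∃ fbtcp fpvcp fcpbt fcped s : Fin T → ℝ,
        Feas2BB1F T Pbt Sbt S0 etain etaout Ppv D fbtcp fpvcp fcpbt fcped s ∧
        c = ENNReal.ofReal (∑ t, (Cpv * fpvcp t + Cbt * fbtcp t))}) ∧
    (sInf {c : ENNReal | ∃ fbtcp fpvcp fcpbt fcped s : Fin T → ℝ,
        Feas2BB1F T Pbt Sbt S0 etain etaout Ppv D fbtcp fpvcp fcpbt fcped s ∧
        c = ENNReal.ofReal (∑ t, (Cpv * fpvcp t + Cbt * fbtcp t))}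
      = sInf {c : ENNReal | ∃ fbtcp fpvcp fcpbt fcped fedcp s : Fin T → ℝ,
        Feas2BB2F T Pbt Sbt S0 etain etaout Ppv D fbtcp fpvcp fcpbt fcped fedcp s ∧
        c = ENNReal.ofReal (∑ t, (Cpv * fpvcp t + Cbt * fbtcp t))}) ∧
    (sInf {c : ENNReal | ∃ fbtcp fpvcp fcpbt fcped fedcp s : Fin T → ℝ,
        Feas2BB2F T Pbt Sbt S0 etain etaout Ppv D fbtcp fpvcp fcpbt fcped fedcp s ∧
        c = ENNReal.ofReal (∑ t, (Cpv * fpvcp t + Cbt * fbtcp t))}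
      = sInf {c : ENNReal | ∃ fbtcp fpvcp fclcp fcpbt fcpcl fcled fedcl s : Fin T → ℝ,
        Feas3BB4F T Pbt Sbt S0 etain etaout Ppv D fbtcp fpvcp fclcp fcpbt fcpcl fcled fedcl s ∧
        c = ENNReal.ofReal (∑ t, (Cpv * fpvcp t + Cbt * fbtcp t))}) := by
  refine ⟨le_antisymm ?_ ?_, ?_, ?_⟩
  · refine le_sInf ?_
    rintro _ ⟨b, p, c, d, s, h, rfl⟩
    obtain ⟨b', c', e', s', h', hle⟩ := h.exists_feas1BB hS0' hin hin1 hout hout1 hD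
    refine sInf_le_of_le ⟨b', c', e', s', h', rfl⟩ (ENNReal.ofReal_le_ofReal ?_)
    exact Finset.sum_le_sum fun t _ => add_le_add
      (mul_le_mul_of_nonneg_left (hle t).1 hCpv) (mul_le_mul_of_nonneg_left (hle t).2 hCbt)
  · refine le_sInf ?_
    rintro _ ⟨b, c, e, s, h, rfl⟩
    refine sInf_le ⟨b, fun t => c t + e t, c, D, s, fun t => ?_, rfl⟩
    obtain ⟨h1, h2, h3, h4, h5, h6, h7, h8, h9, h10⟩ := h t
    exact ⟨h1, add_nonneg h2 h3, h2, hD t, h4, by linarith, rfl, h6, h7, h8, h9, by linarith, h10⟩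
  · congr 1
    ext x
    constructor
    · rintro ⟨b, p, c, d, s, h, rfl⟩
      refine ⟨b, p, c, d, 0, s, fun t => ?_, rfl⟩
      simpa [Feas2BB1F] using h t
    · rintro ⟨b, p, c, d, r, s, h, rfl⟩
      refine ⟨b, p, c, d, s, fun t => ?_, rfl⟩
      obtain ⟨h1, h2, h3, h4, h5, h6, h7, h8, h9, h10, h11, h12, h13, h14, h15⟩ := h t
      exact ⟨h1, h2, h3, h4, h6, by linarith, by linarith, h9, h10, h11, h12, h14, h15⟩
  · congr 1
    ext x
    constructor
    · rintro ⟨b, p, c, d, r, s, h, rfl⟩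
      refine ⟨b, p, 0, c, D, D, 0, s, fun t => ?_, rfl⟩
      obtain ⟨h1, h2, h3, h4, h5, h6, h7, h8, h9, h10, h11, h12, h13, h14, h15⟩ := h t
      have hcap : D t ≤ Pbt + Ppv t := by linarith
      simp only [Pi.zero_apply]
      exact ⟨h1, h2, le_rfl, h3, hD t, hD t, le_rfl, h6, by linarith, by ring, by ring, h9, h10,
        h11, h12, trivial, hcap, hcap, add_nonneg hPbt (hPpv t), h15⟩
    · rintro ⟨b, p, a, c, m, e, r, s, h, rfl⟩
      refine ⟨b, p, c, D, 0, s, fun t => ?_, rfl⟩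
      obtain ⟨h1, h2, h3, h4, h5, h6, h7, h8, h9, h10, h11, h12, h13, h14, h15, h16, h17, h18, h19,
        h20⟩ := h t
      simp only [Pi.zero_apply]
      exact ⟨h1, h2, h4, hD t, le_rfl, h8, by linarith, by ring, h12, h13, h14, h15, trivial,
        by linarith, h20⟩
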